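/- arXiv:1704.02453 — 5 statements merged into one kernel-verified Lean document; each statement's English description precedes it below -/
import Mathlib

section
/- Let F be an ABC counting rule implemented by a counting function f, let ℓ ∈ {1,…,m}, and suppose F restricted to ℓ-regular profiles is non-trivial (there is an ℓ-regular profile A and committees W, W' with W ≻_{F(A)} W'). Let W1, W2, W3 be committees with |W1 ∩ W3| > |W1 ∩ W2|. Then there exist ℓ-regular profiles A* and B* such that: (1) score_f(W1,A*) = score_f(W3,A*) > score_f(W2,A*) and W1 =_{F(A*)} W3 ≻_{F(A*)} W2; and (2) score_f(W1,B*) = score_f(W3,B*) < score_f(W2,B*) and W2 ≻_{F(B*)} W1 =_{F(B*)} W3. -/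
namespace ABC

/-- An approval profile: a list of approval ballots (one per voter),
each ballot a subset of the candidate set `Fin m`. -/
abbrev Profile (m : ℕ) := List (Finset (Fin m))

/-- `n`-fold concatenation of a profile with itself. -/
def nCopies {m : ℕ} (n : ℕ) (A : Profile m) : Profile m := (List.replicate n A).flatten

/-- A counting function `f : {0,…,k} × {0,…,m} → ℝ`, weakly increasing in the
first coordinate. -/
def IsCountingFunction (m k : ℕ) (f : ℕ → ℕ → ℝ) : Prop :=
  ∀ x x' y : ℕ, x' ≤ x → x ≤ k → y ≤ m → f x' y ≤ f x y

/-- The `f`-score of a committee `W` in a profile `A`. -/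
noncomputable def score {m : ℕ} (f : ℕ → ℕ → ℝ) (W : Finset (Fin m)) (A : Profile m) : ℝ :=
  (A.map (fun s => f (s ∩ W).card s.card)).sum

/-- An ABC ranking rule: a weak order (complete, transitive) on committees
(size-`k` subsets of the `m` candidates) for every approval profile. -/
structure ABCRankingRule (m k : ℕ) where
  rel : Profile m → Finset (Fin m) → Finset (Fin m) → Prop
  total : ∀ A W1 W2, W1.card = k → W2.card = k → rel A W1 W2 ∨ rel A W2 W1
  trans : ∀ A W1 W2 W3, W1.card = k → W2.card = k → W3.card = k →
    rel A W1 W2 → rel A W2 W3 → rel A W1 W3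

/-- The strict part of a (weak) relation on committees. -/
def strictOf {ρ : Type} {m : ℕ} (rel : ρ → Finset (Fin m) → Finset (Fin m) → Prop)
    (A : ρ) (W1 W2 : Finset (Fin m)) : Prop :=
  rel A W1 W2 ∧ ¬ rel A W2 W1

def ABCRankingRule.strict {m k : ℕ} (F : ABCRankingRule m k) :
    Profile m → Finset (Fin m) → Finset (Fin m) → Prop :=
  strictOf F.rel

/-- Anonymity: the outcome depends only on the multiset of ballots. -/
def Anonymous (m k : ℕ) (rel : Profile m → Finset (Fin m) → Finset (Fin m) → Prop) : Prop :=
  ∀ A A' : Profile m, A.Perm A' → ∀ W1 W2 : Finset (Fin m), W1.card = k → W2.card = k →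
    (rel A W1 W2 ↔ rel A' W1 W2)

/-- Neutrality: renaming candidates by a permutation renames the outcome accordingly. -/
def Neutral (m k : ℕ) (rel : Profile m → Finset (Fin m) → Finset (Fin m) → Prop) : Prop :=
  ∀ (σ : Equiv.Perm (Fin m)) (A : Profile m) (W1 W2 : Finset (Fin m)),
    W1.card = k → W2.card = k →
    (rel A W1 W2 ↔ rel (A.map (fun s => s.image σ)) (W1.image σ) (W2.image σ))

/-- Consistency for ABC ranking rules. -/
def Consistent (m k : ℕ) (rel : Profile m → Finset (Fin m) → Finset (Fin m) → Prop) : Prop :=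
  ∀ (A A' : Profile m) (W1 W2 : Finset (Fin m)), W1.card = k → W2.card = k →
    (strictOf rel A W1 W2 → rel A' W1 W2 → strictOf rel (A ++ A') W1 W2) ∧
    (rel A W1 W2 → rel A' W1 W2 → rel (A ++ A') W1 W2)

/-- Weak efficiency: if no voter approves any candidate of `W2 \ W1` then `W1 ⪰ W2`. -/
def WeakEfficient (m k : ℕ) (rel : Profile m → Finset (Fin m) → Finset (Fin m) → Prop) : Prop :=
  ∀ (A : Profile m) (W1 W2 : Finset (Fin m)), W1.card = k → W2.card = k →
    (∀ s ∈ A, ∀ c ∈ W2, c ∉ W1 → c ∉ s) → rel A W1 W2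

/-- Efficiency: if every voter approves at least as many members of `W1` as of `W2`
then `W1 ⪰ W2`. -/
def Efficient (m k : ℕ) (rel : Profile m → Finset (Fin m) → Finset (Fin m) → Prop) : Prop :=
  ∀ (A : Profile m) (W1 W2 : Finset (Fin m)), W1.card = k → W2.card = k →
    (∀ s ∈ A, (s ∩ W2).card ≤ (s ∩ W1).card) → rel A W1 W2

/-- Continuity for ABC ranking rules. -/
def Continuous (m k : ℕ) (rel : Profile m → Finset (Fin m) → Finset (Fin m) → Prop) : Prop :=
  ∀ (A A' : Profile m) (W1 W2 : Finset (Fin m)), W1.card = k → W2.card = k →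
    strictOf rel A' W1 W2 → ∃ n : ℕ, strictOf rel (A ++ nCopies n A') W1 W2

/-- A counting function `f` implements an ABC ranking rule `F`. -/
def Implements (m k : ℕ) (f : ℕ → ℕ → ℝ) (F : ABCRankingRule m k) : Prop :=
  ∀ (A : Profile m) (W1 W2 : Finset (Fin m)), W1.card = k → W2.card = k →
    (score f W2 A < score f W1 A ↔ F.strict A W1 W2)

/-- `F` is an ABC counting rule: some counting function implements it. -/
def IsCountingRule (m k : ℕ) (F : ABCRankingRule m k) : Prop :=
  ∃ f : ℕ → ℕ → ℝ, IsCountingFunction m k f ∧ Implements m k f F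

/-- `W` is a winning committee in `F(A)`: it is a maximal element of the weak order. -/
def Winning (m k : ℕ) (F : ABCRankingRule m k) (A : Profile m) (W : Finset (Fin m)) : Prop :=
  W.card = k ∧ ∀ W' : Finset (Fin m), W'.card = k → F.rel A W W'

/-- `A` is a party-list profile with `p` parties with approval sets `Cs 0, …, Cs (p-1)`:
the `Cs i` are pairwise disjoint nonempty sets, every ballot equals some `Cs i`,
and each party has at least one voter. -/
def IsPartyList (m : ℕ) (A : Profile m) (p : ℕ) (Cs : Fin p → Finset (Fin m)) : Prop :=
  (∀ i, (Cs i).Nonempty) ∧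
  (∀ i j, i ≠ j → Disjoint (Cs i) (Cs j)) ∧
  (∀ s ∈ A, ∃ i, s = Cs i) ∧
  (∀ i, Cs i ∈ A)

/-- The number `|N_i|` of voters of party `i`. -/
def partySize {m : ℕ} (A : Profile m) {p : ℕ} (Cs : Fin p → Finset (Fin m)) (i : Fin p) : ℕ :=
  A.count (Cs i)

/-- `W` is D'Hondt proportional for the party-list profile `A`:
for all parties `i, j`: `C_j ⊆ W`, or `W ∩ C_i = ∅`, or
`|N_i|/|W∩C_i| ≥ |N_j|/(|W∩C_j|+1)` (stated cross-multiplied). -/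
def DHondtProportionalFor (m : ℕ) (A : Profile m) (p : ℕ) (Cs : Fin p → Finset (Fin m))
    (W : Finset (Fin m)) : Prop :=
  ∀ i j : Fin p,
    Cs j ⊆ W ∨ W ∩ Cs i = ∅ ∨
    partySize A Cs j * (W ∩ Cs i).card ≤ partySize A Cs i * ((W ∩ Cs j).card + 1)

/-- D'Hondt proportionality for ABC ranking rules. -/
def DHondtProp (m k : ℕ) (F : ABCRankingRule m k) : Prop :=
  ∀ (A : Profile m) (p : ℕ) (Cs : Fin p → Finset (Fin m)), IsPartyList m A p Cs →
    ∀ W : Finset (Fin m), W.card = k →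
      (Winning m k F A W ↔ DHondtProportionalFor m A p Cs W)

/-- The PAV counting function `f_PAV(x,y) = Σ_{i=1}^{x} 1/i`. -/
noncomputable def fPAV : ℕ → ℕ → ℝ := fun x _ => ∑ i ∈ Finset.range x, (1 : ℝ) / (i + 1)

/-- The AV counting function `f_AV(x,y) = x`. -/
def fAV : ℕ → ℕ → ℝ := fun x _ => (x : ℝ)

/-- The Chamberlin–Courant counting function. -/
noncomputable def fCC : ℕ → ℕ → ℝ := fun x _ => if x = 0 then 0 else 1

/-- The union of all approval sets in a profile. -/
def profileUnion {m : ℕ} (A : Profile m) : Finset (Fin m) := A.foldr (· ∪ ·) ∅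

/-- Disjoint equality for ABC ranking rules. -/
def DisjointEquality (m k : ℕ) (F : ABCRankingRule m k) : Prop :=
  ∀ A : Profile m,
    (∀ c : Fin m, A.countP (fun s => decide (c ∈ s)) ≤ 1) →
    k ≤ (profileUnion A).card →
    ∀ W : Finset (Fin m), W.card = k →
      (Winning m k F A W ↔ W ⊆ profileUnion A)

/-- Disjoint diversity for ABC ranking rules, stated for party-list profiles whose
parties are indexed in order of weakly decreasing size. -/
def DisjointDiversity (m k : ℕ) (F : ABCRankingRule m k) : Prop :=
  ∀ (A : Profile m) (p : ℕ) (Cs : Fin p → Finset (Fin m)), IsPartyList m A p Cs →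
    (∀ i j : Fin p, i ≤ j → partySize A Cs j ≤ partySize A Cs i) →
    ∃ W : Finset (Fin m), Winning m k F A W ∧
      ∀ i : Fin p, (i : ℕ) < k → (W ∩ Cs i).Nonempty

/-- Lower quota for ABC ranking rules. -/
def LowerQuota (m k : ℕ) (F : ABCRankingRule m k) : Prop :=
  ∀ (A : Profile m) (p : ℕ) (Cs : Fin p → Finset (Fin m)), IsPartyList m A p Cs →
    ∀ W : Finset (Fin m), Winning m k F A W →
      ∀ i : Fin p,
        k * partySize A Cs i / A.length ≤ (W ∩ Cs i).card ∨
        (Cs i).card < k * partySize A Cs i / A.length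

/-- A trivial ABC ranking rule declares all committees tied on all profiles. -/
def IsTrivialRule (m k : ℕ) (F : ABCRankingRule m k) : Prop :=
  ∀ (A : Profile m) (W1 W2 : Finset (Fin m)), W1.card = k → W2.card = k → F.rel A W1 W2

/-- An `ℓ`-regular profile: every voter approves exactly `ℓ` candidates. -/
def IsRegular (m ℓ : ℕ) (A : Profile m) : Prop := ∀ s ∈ A, s.card = ℓ

/- ### Linear-order (LOC) profiles -/

/-- A profile of linear orders: each voter's ranking is a bijection sending a
candidate to its position (position `0` is the top). -/
abbrev LProfile (m : ℕ) := List (Fin m ≃ Fin m)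

def nCopiesL {m : ℕ} (n : ℕ) (P : LProfile m) : LProfile m := (List.replicate n P).flatten

/-- The set of a voter's top `ℓ` candidates. -/
def apprTop (m ℓ : ℕ) (r : Fin m ≃ Fin m) : Finset (Fin m) :=
  Finset.univ.filter (fun c => (r c : ℕ) < ℓ)

/-- `Appr(P, ℓ)`: the approval profile in which each voter approves her top `ℓ`
candidates. -/
def ApprProfile (m ℓ : ℕ) (P : LProfile m) : Profile m := P.map (apprTop m ℓ)

def LAnonymous (m k : ℕ) (rel : LProfile m → Finset (Fin m) → Finset (Fin m) → Prop) : Prop :=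
  ∀ P P' : LProfile m, P.Perm P' → ∀ W1 W2 : Finset (Fin m), W1.card = k → W2.card = k →
    (rel P W1 W2 ↔ rel P' W1 W2)

def LNeutral (m k : ℕ) (rel : LProfile m → Finset (Fin m) → Finset (Fin m) → Prop) : Prop :=
  ∀ (σ : Equiv.Perm (Fin m)) (P : LProfile m) (W1 W2 : Finset (Fin m)),
    W1.card = k → W2.card = k →
    (rel P W1 W2 ↔ rel (P.map (fun r => σ.symm.trans r)) (W1.image σ) (W2.image σ))

def LConsistent (m k : ℕ) (rel : LProfile m → Finset (Fin m) → Finset (Fin m) → Prop) : Prop :=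
  ∀ (P P' : LProfile m) (W1 W2 : Finset (Fin m)), W1.card = k → W2.card = k →
    (strictOf rel P W1 W2 → rel P' W1 W2 → strictOf rel (P ++ P') W1 W2) ∧
    (rel P W1 W2 → rel P' W1 W2 → rel (P ++ P') W1 W2)

def LContinuous (m k : ℕ) (rel : LProfile m → Finset (Fin m) → Finset (Fin m) → Prop) : Prop :=
  ∀ (P P' : LProfile m) (W1 W2 : Finset (Fin m)), W1.card = k → W2.card = k →
    strictOf rel P' W1 W2 → ∃ n : ℕ, strictOf rel (P ++ nCopiesL n P') W1 W2

/-- `I` dominates `J`: sorted increasingly, the `t`-th element of `I` is at most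
the `t`-th element of `J`. -/
def dominatesPos (m : ℕ) (I J : Finset (Fin m)) : Prop :=
  List.Forall₂ (· ≤ ·) (I.sort (· ≤ ·)) (J.sort (· ≤ ·))

/-- Committee dominance for LOC ranking rules. -/
def LCommitteeDominance (m k : ℕ)
    (rel : LProfile m → Finset (Fin m) → Finset (Fin m) → Prop) : Prop :=
  ∀ (P : LProfile m) (W1 W2 : Finset (Fin m)), W1.card = k → W2.card = k →
    (∀ r ∈ P, dominatesPos m (W1.image ⇑r) (W2.image ⇑r)) → rel P W1 W2

/- ### ABC choice rules -/

/-- An ABC choice rule: a nonempty set of winning committees for every profile. -/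
structure ABCChoiceRule (m k : ℕ) where
  choice : Profile m → Set (Finset (Fin m))
  nonempty : ∀ A, (choice A).Nonempty
  card_eq : ∀ A W, W ∈ choice A → W.card = k

def CAnonymous (m k : ℕ) (R : ABCChoiceRule m k) : Prop :=
  ∀ A A' : Profile m, A.Perm A' → R.choice A = R.choice A'

def CNeutral (m k : ℕ) (R : ABCChoiceRule m k) : Prop :=
  ∀ (σ : Equiv.Perm (Fin m)) (A : Profile m),
    R.choice (A.map (fun s => s.image σ)) = (fun W : Finset (Fin m) => W.image σ) '' R.choice A

def CConsistent (m k : ℕ) (R : ABCChoiceRule m k) : Prop :=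
  ∀ A A' : Profile m, (R.choice A ∩ R.choice A').Nonempty →
    R.choice (A ++ A') = R.choice A ∩ R.choice A'

def CContinuous (m k : ℕ) (R : ABCChoiceRule m k) : Prop :=
  ∀ A A' : Profile m, R.choice A ∩ R.choice A' = ∅ →
    ∃ n : ℕ, R.choice (A ++ nCopies n A') ⊆ R.choice A'

def CWeakEfficient (m k : ℕ) (R : ABCChoiceRule m k) : Prop :=
  ∀ (A : Profile m) (W : Finset (Fin m)), W ∈ R.choice A →
    ∀ c ∈ W, (∀ s ∈ A, c ∉ s) →
      ∀ c' : Fin m, c' ∉ W → insert c' (W.erase c) ∈ R.choice A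

def TwoNonimposition (m k : ℕ) (R : ABCChoiceRule m k) : Prop :=
  ∀ W1 W2 : Finset (Fin m), W1.card = k → W2.card = k →
    ∃ B : Profile m, R.choice B = {W1, W2}

/-- The ranking-side relation `F_R` induced by a choice rule `R` and a map `α`. -/
def relFR (m k : ℕ) (R : ABCChoiceRule m k)
    (α : Finset (Fin m) → Finset (Fin m) → Profile m)
    (A : Profile m) (W1 W2 : Finset (Fin m)) : Prop :=
  ∃ n : ℕ, ∀ n' ≥ n, W1 ∈ R.choice (A ++ nCopies n' (α W1 W2))

def CDHondtProp (m k : ℕ) (R : ABCChoiceRule m k) : Prop :=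
  ∀ (A : Profile m) (p : ℕ) (Cs : Fin p → Finset (Fin m)), IsPartyList m A p Cs →
    ∀ W : Finset (Fin m), W.card = k →
      (W ∈ R.choice A ↔ DHondtProportionalFor m A p Cs W)

def CDisjointDiversity (m k : ℕ) (R : ABCChoiceRule m k) : Prop :=
  ∀ (A : Profile m) (p : ℕ) (Cs : Fin p → Finset (Fin m)), IsPartyList m A p Cs →
    (∀ i j : Fin p, i ≤ j → partySize A Cs j ≤ partySize A Cs i) →
    ∃ W ∈ R.choice A, ∀ i : Fin p, (i : ℕ) < k → (W ∩ Cs i).Nonempty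

/-- A trivial ABC choice rule returns all committees on every profile. -/
def CTrivial (m k : ℕ) (R : ABCChoiceRule m k) : Prop :=
  ∀ A : Profile m, R.choice A = {W : Finset (Fin m) | W.card = k}


/-- The total score of `W` over all ballots of size `ℓ` that approve `c`. -/
noncomputable def candScore {m : ℕ} (f : ℕ → ℕ → ℝ) (ℓ : ℕ) (W : Finset (Fin m))
    (c : Fin m) : ℝ :=
  ∑ s ∈ Finset.univ.filter (fun s : Finset (Fin m) => s.card = ℓ ∧ c ∈ s),
    f (s ∩ W).card s.card

/-- The profile in which each ballot `s` of size `ℓ` is cast `|s ∩ D|` times. -/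
noncomputable def overlapProfile {m : ℕ} (ℓ : ℕ) (D : Finset (Fin m)) : Profile m :=
  D.toList.flatMap fun c =>
    (Finset.univ.filter (fun s : Finset (Fin m) => s.card = ℓ ∧ c ∈ s)).toList

theorem isRegular_overlapProfile {m : ℕ} (ℓ : ℕ) (D : Finset (Fin m)) :
    IsRegular m ℓ (overlapProfile ℓ D) := by
  intro s hs
  simp only [overlapProfile, List.mem_flatMap, Finset.mem_toList, Finset.mem_filter] at hs
  obtain ⟨c, -, -, hs, -⟩ := hs
  exact hs

theorem IsRegular.append {m ℓ : ℕ} {A B : Profile m} (hA : IsRegular m ℓ A)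
    (hB : IsRegular m ℓ B) : IsRegular m ℓ (A ++ B) := by
  intro s hs
  rcases List.mem_append.1 hs with h | h
  exacts [hA s h, hB s h]

theorem score_append {m : ℕ} (f : ℕ → ℕ → ℝ) (W : Finset (Fin m)) (A B : Profile m) :
    score f W (A ++ B) = score f W A + score f W B := by
  simp [score]

theorem score_overlapProfile {m : ℕ} (f : ℕ → ℕ → ℝ) (ℓ : ℕ) (W D : Finset (Fin m)) :
    score f W (overlapProfile ℓ D) = ∑ c ∈ D, candScore f ℓ W c := by
  rw [← Finset.sum_map_toList]
  unfold overlapProfile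
  induction D.toList with
  | nil => simp [score]
  | cons c L ih =>
    rw [List.flatMap_cons, score_append, ih, List.map_cons, List.sum_cons]
    congr 1
    exact Finset.sum_map_toList _ _

theorem candScore_image {m : ℕ} (f : ℕ → ℕ → ℝ) (ℓ : ℕ) (W : Finset (Fin m)) (c : Fin m)
    (σ : Equiv.Perm (Fin m)) :
    candScore f ℓ (W.image σ) (σ c) = candScore f ℓ W c := by
  symm
  refine Finset.sum_equiv (Equiv.finsetCongr σ) (fun s => ?_) (fun s _ => ?_)
  · simp
  · have hW : W.image σ = W.map σ.toEmbedding := by simp [Finset.map_eq_image]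
    rw [Equiv.finsetCongr_apply, hW, ← Finset.map_inter, Finset.card_map, Finset.card_map]

theorem exists_perm_image_eq {m : ℕ} {W W' : Finset (Fin m)} (h : W.card = W'.card) :
    ∃ σ : Equiv.Perm (Fin m), W.image σ = W' := by
  refine ⟨(Finset.equivOfCardEq h).extendSubtype, ?_⟩
  refine Finset.eq_of_subset_of_card_le (fun x hx => ?_) ?_
  · obtain ⟨y, hy, rfl⟩ := Finset.mem_image.1 hx
    exact Equiv.extendSubtype_mem _ _ hy
  · rw [Finset.card_image_of_injective _ (Equiv.injective _), h]

theorem image_swap_eq_self {m : ℕ} {W : Finset (Fin m)} {c d : Fin m} (h : c ∈ W ↔ d ∈ W) :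
    W.image (Equiv.swap c d) = W := by
  refine Finset.eq_of_subset_of_card_le (fun x hx => ?_) ?_
  · obtain ⟨y, hy, rfl⟩ := Finset.mem_image.1 hx
    rw [Equiv.swap_apply_def]
    split_ifs <;> simp_all
  · rw [Finset.card_image_of_injective _ (Equiv.injective _)]

theorem candScore_congr {m : ℕ} (f : ℕ → ℕ → ℝ) (ℓ : ℕ) {W W' : Finset (Fin m)} {c c' : Fin m}
    (h : W.card = W'.card) (hc : c ∈ W ↔ c' ∈ W') :
    candScore f ℓ W c = candScore f ℓ W' c' := by
  obtain ⟨σ, rfl⟩ := exists_perm_image_eq h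
  have hσ : σ c ∈ W.image σ ↔ c' ∈ W.image σ := by
    rw [← hc, Finset.mem_image]
    simp
  rw [← candScore_image f ℓ W c σ, ← candScore_image f ℓ _ (σ c) (Equiv.swap (σ c) c'),
    image_swap_eq_self hσ, Equiv.swap_apply_left]

theorem image_swap_eq_insert_erase {m : ℕ} {W : Finset (Fin m)} {c d : Fin m}
    (hc : c ∈ W) (hd : d ∉ W) : W.image (Equiv.swap c d) = insert d (W.erase c) := by
  ext x
  rw [Finset.mem_image]
  constructor
  · rintro ⟨y, hy, rfl⟩
    rw [Equiv.swap_apply_def]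
    split_ifs <;> simp_all
  · intro hx
    refine ⟨Equiv.swap c d x, ?_, Equiv.swap_apply_self _ _ _⟩
    rw [Equiv.swap_apply_def]
    split_ifs <;> simp_all

theorem card_inter_insert_erase_le {m : ℕ} {s W : Finset (Fin m)} {c d : Fin m}
    (hs : c ∈ s) (hc : c ∈ W) :
    (s ∩ insert d (W.erase c)).card ≤ (s ∩ W).card := by
  have hsub : s ∩ insert d (W.erase c) ⊆ insert d ((s ∩ W).erase c) := by
    intro x hx
    simp only [Finset.mem_inter, Finset.mem_insert, Finset.mem_erase] at hx ⊢
    tauto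
  calc (s ∩ insert d (W.erase c)).card ≤ (insert d ((s ∩ W).erase c)).card :=
        Finset.card_le_card hsub
    _ ≤ ((s ∩ W).erase c).card + 1 := Finset.card_insert_le _ _
    _ = (s ∩ W).card := Finset.card_erase_add_one (Finset.mem_inter.2 ⟨hs, hc⟩)

/-- If all single-candidate exchanges fix a function on `k`-sets, it is constant. -/
theorem eq_of_exchange_invariant {α β : Type*} [DecidableEq α] {k : ℕ} {g : Finset α → β}
    (hg : ∀ W : Finset α, W.card = k → ∀ c ∈ W, ∀ d ∉ W, g (insert d (W.erase c)) = g W)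
    {W W' : Finset α} (hW : W.card = k) (hW' : W'.card = k) : g W = g W' := by
  induction hn : (W \ W').card generalizing W with
  | zero =>
    rw [Finset.card_eq_zero, Finset.sdiff_eq_empty_iff_subset] at hn
    rw [Finset.eq_of_subset_of_card_le hn (by omega)]
  | succ n ih =>
    obtain ⟨c, hc⟩ := Finset.card_pos.1 (by omega : 0 < (W \ W').card)
    have hcard := Finset.card_sdiff_comm (hW.trans hW'.symm)
    obtain ⟨d, hd⟩ := Finset.card_pos.1 (by omega : 0 < (W' \ W).card)
    rw [Finset.mem_sdiff] at hd
    have hc' := Finset.mem_sdiff.1 hc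
    rw [← hg W hW c hc'.1 d hd.2]
    apply ih
    · rw [Finset.card_insert_of_notMem (by simp [hd.2]), Finset.card_erase_add_one hc'.1, hW]
    · have : insert d (W.erase c) \ W' = (W \ W').erase c := by
        ext x
        simp only [Finset.mem_sdiff, Finset.mem_insert, Finset.mem_erase]
        constructor
        · rintro ⟨rfl | h, h'⟩
          · exact absurd hd.1 h'
          · exact ⟨h.1, h.2, h'⟩
        · rintro ⟨h, h', h''⟩
          exact ⟨Or.inr ⟨h, h'⟩, h''⟩
      rw [this, Finset.card_erase_of_mem hc, hn, Nat.add_sub_cancel]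

/-- A non-constant counting function strictly rewards some approved exchange. -/
theorem exists_candScore_lt {m k ℓ : ℕ} {f : ℕ → ℕ → ℝ} (hf : IsCountingFunction m k f)
    {s W W' : Finset (Fin m)} (hs : s.card = ℓ) (hW : W.card = k) (hW' : W'.card = k)
    (hne : f (s ∩ W).card ℓ ≠ f (s ∩ W').card ℓ) :
    ∃ (V : Finset (Fin m)) (c d : Fin m), V.card = k ∧ c ∈ V ∧ d ∉ V ∧
      candScore f ℓ V d < candScore f ℓ V c := by
  by_contra! hcon
  have key : ∀ V : Finset (Fin m), V.card = k → ∀ c ∈ V, ∀ d ∉ V, c ∈ s →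
      f (s ∩ insert d (V.erase c)).card ℓ = f (s ∩ V).card ℓ := by
    intro V hV c hc d hd hcs
    have hle : ∀ t ∈ Finset.univ.filter (fun t : Finset (Fin m) => t.card = ℓ ∧ c ∈ t),
        f (t ∩ insert d (V.erase c)).card t.card ≤ f (t ∩ V).card t.card := by
      intro t ht
      refine hf _ _ _ (card_inter_insert_erase_le (Finset.mem_filter.1 ht).2.2 hc) ?_ ?_
      · exact hV ▸ Finset.card_le_card Finset.inter_subset_right
      · simpa using Finset.card_le_univ t
    have hd' : candScore f ℓ V d = candScore f ℓ (insert d (V.erase c)) c := by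
      rw [← image_swap_eq_insert_erase hc hd, ← candScore_image f ℓ V d (Equiv.swap c d),
        Equiv.swap_apply_right]
    have heq := le_antisymm (Finset.sum_le_sum hle) ((hcon V c d hV hc hd).trans_eq hd')
    have := (Finset.sum_eq_sum_iff_of_le hle).1 heq s (by simp [hs, hcs])
    rwa [hs] at this
  refine hne (eq_of_exchange_invariant (g := fun V => f (s ∩ V).card ℓ) ?_ hW hW')
  intro V hV c hc d hd
  by_cases hcs : c ∈ s
  · exact key V hV c hc d hd hcs
  have hcd : c ≠ d := fun h => hd (h ▸ hc)
  have hback : insert c ((insert d (V.erase c)).erase d) = V := by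
    rw [Finset.erase_insert (by simp [hd]), Finset.insert_erase hc]
  by_cases hds : d ∈ s
  · have hcard : (insert d (V.erase c)).card = k := by
      rw [Finset.card_insert_of_notMem (by simp [hd]), Finset.card_erase_add_one hc, hV]
    have := key _ hcard d (Finset.mem_insert_self _ _) c (by simp [hcd]) hds
    rw [hback] at this
    exact this.symm
  · have : s ∩ insert d (V.erase c) = s ∩ V := by
      ext x
      simp only [Finset.mem_inter, Finset.mem_insert, Finset.mem_erase]
      constructor
      · rintro ⟨hx, rfl | h⟩
        · exact absurd hx hds
        · exact ⟨hx, h.2⟩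
      · rintro ⟨hx, h⟩
        exact ⟨hx, Or.inr ⟨fun h => hcs (h ▸ hx), h⟩⟩
    simp only [this]

theorem exists_ballot_ne_of_score_ne {m : ℕ} {f : ℕ → ℕ → ℝ} {A : Profile m}
    {W W' : Finset (Fin m)} (h : score f W A ≠ score f W' A) :
    ∃ s ∈ A, f (s ∩ W).card s.card ≠ f (s ∩ W').card s.card := by
  by_contra! hcon
  exact h (congrArg List.sum (List.map_congr_left hcon))

/-- On overlap profiles, the score is affine and strictly increasing in the overlap. -/
theorem exists_score_overlapProfile_eq {m k ℓ : ℕ} {f : ℕ → ℕ → ℝ}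
    (hf : IsCountingFunction m k f) {s W W' : Finset (Fin m)} (hs : s.card = ℓ)
    (hW : W.card = k) (hW' : W'.card = k) (hne : f (s ∩ W).card ℓ ≠ f (s ∩ W').card ℓ) :
    ∃ a b : ℝ, 0 < a ∧ ∀ U D : Finset (Fin m), U.card = k →
      score f U (overlapProfile ℓ D) = a * (U ∩ D).card + b * D.card := by
  obtain ⟨V, c, d, hV, hc, hd, hlt⟩ := exists_candScore_lt hf hs hW hW' hne
  refine ⟨candScore f ℓ V c - candScore f ℓ V d, candScore f ℓ V d, sub_pos.2 hlt,
    fun U D hU => ?_⟩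
  have hval : ∀ e ∈ D, candScore f ℓ U e =
      (candScore f ℓ V c - candScore f ℓ V d) * (if e ∈ U then 1 else 0) +
        candScore f ℓ V d := by
    intro e _
    by_cases he : e ∈ U
    · rw [candScore_congr f ℓ (hU.trans hV.symm) (c' := c) (by simp [he, hc])]
      simp [he]
    · rw [candScore_congr f ℓ (hU.trans hV.symm) (c' := d) (by simp [he, hd])]
      simp [he]
  rw [score_overlapProfile, Finset.sum_congr rfl hval, Finset.sum_add_distrib,
    ← Finset.mul_sum, Finset.sum_boole, Finset.sum_const, nsmul_eq_mul,
    Finset.filter_mem_eq_inter, Finset.inter_comm D U]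
  ring

theorem Implements.rel_of_score_le {m k : ℕ} {f : ℕ → ℕ → ℝ} {F : ABCRankingRule m k}
    (h : Implements m k f F) {A : Profile m} {W W' : Finset (Fin m)} (hW : W.card = k)
    (hW' : W'.card = k) (hle : score f W' A ≤ score f W A) : F.rel A W W' := by
  by_contra hrel
  exact hle.not_gt ((h A W' W hW' hW).2 ⟨(F.total A W W' hW hW').resolve_left hrel, hrel⟩)

/-- existence of the `ℓ`-regular profiles `A*` and `B*`
(Lemma on profiles `A_ℓ^*` and `B_ℓ^*`). -/
theorem statement10 (m k : ℕ) (hk : 0 < k) (hkm : k < m)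
    (F : ABCRankingRule m k) (f : ℕ → ℕ → ℝ)
    (hf : IsCountingFunction m k f) (himpl : Implements m k f F)
    (ℓ : ℕ) (hℓ1 : 1 ≤ ℓ) (hℓm : ℓ ≤ m)
    (hnontriv : ∃ (A : Profile m) (W W' : Finset (Fin m)),
      IsRegular m ℓ A ∧ W.card = k ∧ W'.card = k ∧ F.strict A W W')
    (W1 W2 W3 : Finset (Fin m)) (h1 : W1.card = k) (h2 : W2.card = k)
    (h3 : W3.card = k) (hcap : (W1 ∩ W2).card < (W1 ∩ W3).card) :
    (∃ A : Profile m, IsRegular m ℓ A ∧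
      score f W1 A = score f W3 A ∧ score f W2 A < score f W1 A ∧
      F.rel A W1 W3 ∧ F.rel A W3 W1 ∧ F.strict A W1 W2 ∧ F.strict A W3 W2) ∧
    (∃ B : Profile m, IsRegular m ℓ B ∧
      score f W1 B = score f W3 B ∧ score f W1 B < score f W2 B ∧
      F.rel B W1 W3 ∧ F.rel B W3 W1 ∧ F.strict B W2 W1 ∧ F.strict B W2 W3) := by
  obtain ⟨A, W, W', hA, hW, hW', hstrict⟩ := hnontriv
  obtain ⟨s, hsA, hne⟩ := exists_ballot_ne_of_score_ne ((himpl A W W' hW hW').2 hstrict).ne'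
  rw [hA s hsA] at hne
  obtain ⟨a, b, ha, hscore⟩ := exists_score_overlapProfile_eq hf (hA s hsA) hW hW' hne
  have hcompl : ∀ U D : Finset (Fin m), U.card = k →
      ((U ∩ Dᶜ).card : ℝ) = k - (U ∩ D).card := by
    intro U D hU
    rw [← Finset.sdiff_eq_inter_compl, ← hU, ← Finset.card_inter_add_card_sdiff U D]
    push_cast
    ring
  have hlt : ((W1 ∩ W2).card : ℝ) + (W2 ∩ W3).card < k + (W1 ∩ W3).card := by
    have := h2 ▸ Finset.card_le_card (Finset.inter_subset_left : W2 ∩ W3 ⊆ W2)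
    exact_mod_cast (by omega : (W1 ∩ W2).card + (W2 ∩ W3).card < k + (W1 ∩ W3).card)
  constructor
  · have e13 : score f W1 (overlapProfile ℓ W1 ++ overlapProfile ℓ W3) =
        score f W3 (overlapProfile ℓ W1 ++ overlapProfile ℓ W3) := by
      simp only [score_append, hscore _ _ h1, hscore _ _ h3, Finset.inter_self, h1, h3,
        Finset.inter_comm W3 W1]
      ring
    have l21 : score f W2 (overlapProfile ℓ W1 ++ overlapProfile ℓ W3) <
        score f W1 (overlapProfile ℓ W1 ++ overlapProfile ℓ W3) := by
      simp only [score_append, hscore _ _ h1, hscore _ _ h2, Finset.inter_self, h1,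
        Finset.inter_comm W2 W1]
      linarith [mul_lt_mul_of_pos_left hlt ha]
    exact ⟨_, (isRegular_overlapProfile ℓ W1).append (isRegular_overlapProfile ℓ W3), e13, l21,
      himpl.rel_of_score_le h1 h3 e13.ge, himpl.rel_of_score_le h3 h1 e13.le,
      (himpl _ _ _ h1 h2).1 l21, (himpl _ _ _ h3 h2).1 (e13 ▸ l21)⟩
  · have e13 : score f W1 (overlapProfile ℓ W1ᶜ ++ overlapProfile ℓ W3ᶜ) =
        score f W3 (overlapProfile ℓ W1ᶜ ++ overlapProfile ℓ W3ᶜ) := by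
      simp only [score_append, hscore _ _ h1, hscore _ _ h3, hcompl _ _ h1, hcompl _ _ h3,
        Finset.inter_self, h1, h3, Finset.inter_comm W3 W1]
      ring
    have l12 : score f W1 (overlapProfile ℓ W1ᶜ ++ overlapProfile ℓ W3ᶜ) <
        score f W2 (overlapProfile ℓ W1ᶜ ++ overlapProfile ℓ W3ᶜ) := by
      simp only [score_append, hscore _ _ h1, hscore _ _ h2, hcompl _ _ h1, hcompl _ _ h2,
        Finset.inter_self, h1, Finset.inter_comm W2 W1]
      linarith [mul_lt_mul_of_pos_left hlt ha]
    exact ⟨_, (isRegular_overlapProfile ℓ W1ᶜ).append (isRegular_overlapProfile ℓ W3ᶜ), e13,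
      l12, himpl.rel_of_score_le h1 h3 e13.ge, himpl.rel_of_score_le h3 h1 e13.le,
      (himpl _ _ _ h2 h1).1 l12, (himpl _ _ _ h2 h3).1 (e13 ▸ l12)⟩

end ABC
end

section
/- Let F be an ABC ranking rule satisfying symmetry, consistency, efficiency, and continuity. For each ℓ ∈ {1,…,m}, define the LOC ranking rule G_ℓ by G_ℓ(P) = F(Appr(P,ℓ)) for every profile of linear orders P. Then G_ℓ satisfies anonymity, neutrality, consistency, committee dominance, and continuity (as axioms for LOC ranking rules). -/
namespace ABC

theorem apprProfile_append {m ℓ : ℕ} (P P' : LProfile m) :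
    ApprProfile m ℓ (P ++ P') = ApprProfile m ℓ P ++ ApprProfile m ℓ P' :=
  List.map_append

theorem apprProfile_nCopiesL {m ℓ : ℕ} (n : ℕ) (P : LProfile m) :
    ApprProfile m ℓ (nCopiesL n P) = nCopies n (ApprProfile m ℓ P) := by
  simp [ApprProfile, nCopiesL, nCopies, List.map_flatten]

theorem mem_apprTop {m ℓ : ℕ} {r : Fin m ≃ Fin m} {c : Fin m} :
    c ∈ apprTop m ℓ r ↔ (r c : ℕ) < ℓ := by
  simp [apprTop]

theorem apprTop_symm_trans {m ℓ : ℕ} (σ : Equiv.Perm (Fin m)) (r : Fin m ≃ Fin m) :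
    apprTop m ℓ (σ.symm.trans r) = (apprTop m ℓ r).image σ := by
  ext c
  simp only [mem_apprTop, Finset.mem_image, Equiv.trans_apply]
  exact ⟨fun h => ⟨σ.symm c, h, σ.apply_symm_apply c⟩, by rintro ⟨d, hd, rfl⟩; simpa using hd⟩

theorem apprProfile_map_symm_trans {m ℓ : ℕ} (σ : Equiv.Perm (Fin m)) (P : LProfile m) :
    ApprProfile m ℓ (P.map (fun r => σ.symm.trans r)) =
      (ApprProfile m ℓ P).map (fun s => s.image σ) := by
  simp [ApprProfile, apprTop_symm_trans]

theorem countP_le_of_forall₂_le {m ℓ : ℕ} {I J : List (Fin m)}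
    (h : List.Forall₂ (· ≤ ·) I J) :
    J.countP (fun i : Fin m => decide ((i : ℕ) < ℓ)) ≤ I.countP (fun i : Fin m => decide ((i : ℕ) < ℓ)) := by
  induction h with
  | nil => simp
  | cons hab _ ih =>
    have hab' := Fin.le_def.mp hab
    simp only [List.countP_cons, decide_eq_true_eq]
    split_ifs <;> omega

theorem card_apprTop_inter {m ℓ : ℕ} (r : Fin m ≃ Fin m) (W : Finset (Fin m)) :
    (apprTop m ℓ r ∩ W).card =
      ((W.image r).sort (· ≤ ·)).countP (fun i : Fin m => decide ((i : ℕ) < ℓ)) := by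
  have h : (apprTop m ℓ r ∩ W).image r = (W.image r).filter (fun i : Fin m => (i : ℕ) < ℓ) := by
    ext i
    simp only [mem_apprTop, Finset.mem_image, Finset.mem_inter, Finset.mem_filter]
    constructor
    · rintro ⟨c, ⟨hc, hW⟩, rfl⟩
      exact ⟨⟨c, hW, rfl⟩, hc⟩
    · rintro ⟨⟨c, hW, rfl⟩, hc⟩
      exact ⟨c, ⟨hc, hW⟩, rfl⟩
  rw [← Finset.card_image_of_injective _ r.injective, h, Finset.card_def, Finset.filter_val,
    ← Multiset.countP_eq_card_filter, ← Finset.sort_eq (W.image r) (· ≤ ·), Multiset.coe_countP]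

theorem card_apprTop_inter_le {m ℓ : ℕ} {r : Fin m ≃ Fin m} {W1 W2 : Finset (Fin m)}
    (h : dominatesPos m (W1.image r) (W2.image r)) :
    (apprTop m ℓ r ∩ W2).card ≤ (apprTop m ℓ r ∩ W1).card := by
  rw [card_apprTop_inter, card_apprTop_inter]
  exact countP_le_of_forall₂_le h

/-- if `F` satisfies symmetry, consistency, efficiency, and
continuity, then for each `ℓ ∈ {1,…,m}` the LOC ranking rule
`G_ℓ(P) = F(Appr(P,ℓ))` satisfies anonymity, neutrality, consistency,
committee dominance, and continuity. -/
theorem statement11 (m k : ℕ) (hk : 0 < k) (hkm : k < m) (F : ABCRankingRule m k)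
    (hA : Anonymous m k F.rel) (hN : Neutral m k F.rel)
    (hC : Consistent m k F.rel) (hE : Efficient m k F.rel)
    (hCont : Continuous m k F.rel)
    (ℓ : ℕ) (hℓ1 : 1 ≤ ℓ) (hℓm : ℓ ≤ m) :
    LAnonymous m k (fun P => F.rel (ApprProfile m ℓ P)) ∧
    LNeutral m k (fun P => F.rel (ApprProfile m ℓ P)) ∧
    LConsistent m k (fun P => F.rel (ApprProfile m ℓ P)) ∧
    LCommitteeDominance m k (fun P => F.rel (ApprProfile m ℓ P)) ∧
    LContinuous m k (fun P => F.rel (ApprProfile m ℓ P)) := by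
  refine ⟨fun P P' h => hA _ _ (h.map _), fun σ P W1 W2 h1 h2 => ?_,
    fun P P' W1 W2 h1 h2 => ?_, fun P W1 W2 h1 h2 h => hE _ _ _ h1 h2 fun s hs => ?_,
    fun P P' W1 W2 h1 h2 h => ?_⟩
  · simp only [apprProfile_map_symm_trans]
    exact hN σ _ W1 W2 h1 h2
  · simp only [strictOf, apprProfile_append]
    exact hC _ _ W1 W2 h1 h2
  · obtain ⟨r, hr, rfl⟩ := List.mem_map.mp hs
    exact card_apprTop_inter_le (h r hr)
  · simp only [strictOf, apprProfile_append, apprProfile_nCopiesL]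
    exact hCont _ _ W1 W2 h1 h2 h

end ABC
end

section
/- Let R be an ABC choice rule satisfying symmetry, consistency, continuity, and 2-Nonimposition. Let α and α' be two maps assigning to each pair of committees (W1, W2) a profile with R(α(W1,W2)) = R(α'(W1,W2)) = {W1, W2}. Then for all committees W1, W2 and every approval profile A: (there exists s such that W1 ∈ R(A + s'·α(W1,W2)) for all s' ≥ s) if and only if (there exists t such that W1 ∈ R(A + t'·α'(W1,W2)) for all t' ≥ t). -/
namespace ABC

theorem nCopies_succ {m : ℕ} (n : ℕ) (P : Profile m) :
    nCopies (n + 1) P = nCopies n P ++ P := by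
  simp [nCopies, List.replicate_succ']

theorem nCopies_add {m : ℕ} (n j : ℕ) (P : Profile m) :
    nCopies (n + j) P = nCopies n P ++ nCopies j P := by
  rw [nCopies, List.replicate_add, List.flatten_append, nCopies, nCopies]

theorem CConsistent.choice_append_nCopies_eq {m k : ℕ} {R : ABCChoiceRule m k}
    (hCo : CConsistent m k R) {B P : Profile m} (h : R.choice B ⊆ R.choice P) (n : ℕ) :
    R.choice (B ++ nCopies n P) = R.choice B := by
  induction n with
  | zero => simp [nCopies]
  | succ n ih =>
    have hinter : R.choice (B ++ nCopies n P) ∩ R.choice P = R.choice B := by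
      rw [ih, Set.inter_eq_left.mpr h]
    rw [nCopies_succ, ← List.append_assoc, hCo _ _ (hinter ▸ R.nonempty B), hinter]

theorem CConsistent.eventually_choice_append_nCopies_subset {m k : ℕ} {R : ABCChoiceRule m k}
    (hCo : CConsistent m k R) (hCt : CContinuous m k R) (A P : Profile m) :
    ∃ n, ∀ n' ≥ n, R.choice (A ++ nCopies n' P) ⊆ R.choice P := by
  obtain ⟨n, hn⟩ : ∃ n, R.choice (A ++ nCopies n P) ⊆ R.choice P := by
    rcases (R.choice A ∩ R.choice P).eq_empty_or_nonempty with h | h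
    · exact hCt A P h
    · refine ⟨1, ?_⟩
      have h1 : nCopies 1 P = P := by simp [nCopies]
      rw [h1, hCo A P h]
      exact Set.inter_subset_right
  refine ⟨n, fun n' hn' => ?_⟩
  obtain ⟨j, rfl⟩ := Nat.exists_eq_add_of_le hn'
  rwa [nCopies_add, ← List.append_assoc, hCo.choice_append_nCopies_eq hn]

/-- Two profiles with the same winning committees have the same effect as tie-breakers
when added sufficiently often. -/
theorem CConsistent.eventually_mem_choice_of_choice_eq {m k : ℕ} {R : ABCChoiceRule m k}
    (hAn : CAnonymous m k R) (hCo : CConsistent m k R) (hCt : CContinuous m k R)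
    {P Q : Profile m} (hPQ : R.choice P = R.choice Q) {A : Profile m} {W : Finset (Fin m)}
    (h : ∃ s, ∀ s' ≥ s, W ∈ R.choice (A ++ nCopies s' P)) :
    ∃ t, ∀ t' ≥ t, W ∈ R.choice (A ++ nCopies t' Q) := by
  obtain ⟨s, hs⟩ := h
  obtain ⟨p, hp⟩ := hCo.eventually_choice_append_nCopies_subset hCt A P
  obtain ⟨q, hq⟩ := hCo.eventually_choice_append_nCopies_subset hCt A Q
  refine ⟨q, fun t ht => ?_⟩
  set u := max s p
  have hperm : ((A ++ nCopies t Q) ++ nCopies u P).Perm ((A ++ nCopies u P) ++ nCopies t Q) := by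
    simpa only [List.append_assoc] using List.perm_append_comm.append_left A
  rw [← hCo.choice_append_nCopies_eq (hPQ ▸ hq t ht) u, hAn _ _ hperm,
    hCo.choice_append_nCopies_eq (hPQ ▸ hp u (le_max_right s p)) t]
  exact hs u (le_max_left s p)

/-- the relation `F_R` does not depend on the choice of the map
`α` witnessing 2-Nonimposition. -/
theorem statement12 (m k : ℕ) (hk : 0 < k) (hkm : k < m) (R : ABCChoiceRule m k)
    (hAn : CAnonymous m k R) (hNe : CNeutral m k R) (hCo : CConsistent m k R)
    (hCt : CContinuous m k R) (h2 : TwoNonimposition m k R)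
    (α α' : Finset (Fin m) → Finset (Fin m) → Profile m)
    (hα : ∀ W1 W2 : Finset (Fin m), W1.card = k → W2.card = k →
      R.choice (α W1 W2) = {W1, W2})
    (hα' : ∀ W1 W2 : Finset (Fin m), W1.card = k → W2.card = k →
      R.choice (α' W1 W2) = {W1, W2}) :
    ∀ (W1 W2 : Finset (Fin m)), W1.card = k → W2.card = k → ∀ A : Profile m,
      ((∃ s : ℕ, ∀ s' ≥ s, W1 ∈ R.choice (A ++ nCopies s' (α W1 W2))) ↔
       (∃ t : ℕ, ∀ t' ≥ t, W1 ∈ R.choice (A ++ nCopies t' (α' W1 W2)))) := by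
  intro W1 W2 hW1 hW2 A
  have hPQ : R.choice (α W1 W2) = R.choice (α' W1 W2) :=
    (hα W1 W2 hW1 hW2).trans (hα' W1 W2 hW1 hW2).symm
  exact ⟨hCo.eventually_mem_choice_of_choice_eq hAn hCt hPQ,
    hCo.eventually_mem_choice_of_choice_eq hAn hCt hPQ.symm⟩

end ABC
end

section
/- Let R be an ABC choice rule satisfying symmetry, consistency, continuity, and 2-Nonimposition, and let α assign to each pair of committees (W1, W2) a profile with R(α(W1,W2)) = {W1, W2}. Then for every approval profile A and all committees W1, W2, at least one of the following holds: (there exists n such that W1 ∈ R(A + n'·α(W1,W2)) for all n' ≥ n), or (there exists n such that W2 ∈ R(A + n'·α(W1,W2)) for all n' ≥ n). -/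
namespace ABC

/-- A committee that wins under both `A` and `B` still wins after appending copies of `B`. -/
lemma CConsistent.mem_choice_append_nCopies {m k : ℕ} {R : ABCChoiceRule m k}
    (hCo : CConsistent m k R) {A B : Profile m} {W : Finset (Fin m)} (hA : W ∈ R.choice A)
    (hB : W ∈ R.choice B) (n : ℕ) : W ∈ R.choice (A ++ nCopies n B) := by
  induction n with
  | zero => simpa [nCopies] using hA
  | succ n ih =>
    have h : A ++ nCopies (n + 1) B = (A ++ nCopies n B) ++ B := by
      simp [nCopies, List.replicate_succ']
    rw [h, hCo _ _ ⟨W, ih, hB⟩]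
    exact ⟨ih, hB⟩

/-- A committee that wins under `B` and under `A` with some number of copies of `B` appended
wins eventually. -/
lemma CConsistent.eventually_mem_choice {m k : ℕ} {R : ABCChoiceRule m k}
    (hCo : CConsistent m k R) {A B : Profile m} {W : Finset (Fin m)} {n : ℕ}
    (hA : W ∈ R.choice (A ++ nCopies n B)) (hB : W ∈ R.choice B) :
    ∀ n' ≥ n, W ∈ R.choice (A ++ nCopies n' B) := by
  intro n' hn
  obtain ⟨j, rfl⟩ := Nat.exists_eq_add_of_le hn
  have h : A ++ nCopies (n + j) B = (A ++ nCopies n B) ++ nCopies j B := by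
    rw [nCopies, List.replicate_add, List.flatten_append, ← List.append_assoc]; rfl
  exact h ▸ hCo.mem_choice_append_nCopies hA hB j

/-- Under continuity, some number of copies of `B` makes some winner of `B` win. -/
lemma CContinuous.exists_mem_choice {m k : ℕ} {R : ABCChoiceRule m k}
    (hCt : CContinuous m k R) (A B : Profile m) :
    ∃ n, ∃ W ∈ R.choice B, W ∈ R.choice (A ++ nCopies n B) := by
  rcases (R.choice A ∩ R.choice B).eq_empty_or_nonempty with h | ⟨W, hA, hB⟩
  · obtain ⟨n, hn⟩ := hCt A B h
    obtain ⟨W, hW⟩ := R.nonempty (A ++ nCopies n B)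
    exact ⟨n, W, hn hW, hW⟩
  · exact ⟨0, W, hB, by simpa [nCopies] using hA⟩

/-- completeness of the relation defined from a choice rule `R`:
for every profile `A` and committees `W1, W2`, eventually `W1` or eventually
`W2` is among the winners of `A + n'·α(W1,W2)`. -/
theorem statement13 (m k : ℕ) (hk : 0 < k) (hkm : k < m) (R : ABCChoiceRule m k)
    (hAn : CAnonymous m k R) (hNe : CNeutral m k R) (hCo : CConsistent m k R)
    (hCt : CContinuous m k R) (h2 : TwoNonimposition m k R)
    (α : Finset (Fin m) → Finset (Fin m) → Profile m)
    (hα : ∀ W1 W2 : Finset (Fin m), W1.card = k → W2.card = k →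
      R.choice (α W1 W2) = {W1, W2}) :
    ∀ (A : Profile m) (W1 W2 : Finset (Fin m)), W1.card = k → W2.card = k →
      (∃ n : ℕ, ∀ n' ≥ n, W1 ∈ R.choice (A ++ nCopies n' (α W1 W2))) ∨
      (∃ n : ℕ, ∀ n' ≥ n, W2 ∈ R.choice (A ++ nCopies n' (α W1 W2))) := by
  intro A W1 W2 h1 h2
  obtain ⟨n, W, hB, hW⟩ := hCt.exists_mem_choice A (α W1 W2)
  have hev := hCo.eventually_mem_choice hW hB
  rw [hα W1 W2 h1 h2] at hB
  rcases hB with rfl | rfl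
  · exact Or.inl ⟨n, hev⟩
  · exact Or.inr ⟨n, hev⟩

end ABC
end

section
/- Let R be an ABC choice rule satisfying symmetry, consistency, continuity, and 2-Nonimposition, and let F_R be the family of relations defined from R via a fixed map α. Then for every approval profile A and every committee W: W ∈ R(A) if and only if W is winning in F_R(A), i.e., W ⪰_{F_R(A)} W' holds for every committee W'. -/
namespace ABC

/-- A consistent choice rule is unaffected by replicating a profile a positive number of times. -/
theorem CConsistent.choice_nCopies_succ {m k : ℕ} {R : ABCChoiceRule m k}
    (hR : CConsistent m k R) (A : Profile m) (n : ℕ) :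
    R.choice (nCopies (n + 1) A) = R.choice A := by
  induction n with
  | zero => simp [nCopies]
  | succ n ih =>
    have hsplit : nCopies (n + 1 + 1) A = A ++ nCopies (n + 1) A := by
      simp [nCopies, List.replicate_succ]
    have hne : (R.choice A ∩ R.choice (nCopies (n + 1) A)).Nonempty := by
      rw [ih, Set.inter_self]
      exact R.nonempty A
    rw [hsplit, hR _ _ hne, ih, Set.inter_self]

/-- the winners of `R` coincide with the maximal committees of the
induced relation `F_R`. -/
theorem statement15 (m k : ℕ) (hk : 0 < k) (hkm : k < m) (R : ABCChoiceRule m k)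
    (hAn : CAnonymous m k R) (hNe : CNeutral m k R) (hCo : CConsistent m k R)
    (hCt : CContinuous m k R) (h2 : TwoNonimposition m k R)
    (α : Finset (Fin m) → Finset (Fin m) → Profile m)
    (hα : ∀ W1 W2 : Finset (Fin m), W1.card = k → W2.card = k →
      R.choice (α W1 W2) = {W1, W2}) :
    ∀ (A : Profile m) (W : Finset (Fin m)), W.card = k →
      (W ∈ R.choice A ↔ ∀ W' : Finset (Fin m), W'.card = k → relFR m k R α A W W') := by
  intro A W hW
  constructor
  · intro hWA W' hW'
    refine ⟨1, fun n hn => ?_⟩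
    obtain ⟨n, rfl⟩ := Nat.exists_eq_add_of_le' hn
    have hmem : W ∈ R.choice A ∩ R.choice (nCopies (n + 1) (α W W')) := by
      rw [hCo.choice_nCopies_succ, hα W W' hW hW']
      exact ⟨hWA, Set.mem_insert W {W'}⟩
    rw [hCo _ _ ⟨W, hmem⟩]
    exact hmem
  · intro hwin
    obtain ⟨W', hW'A⟩ := R.nonempty A
    have hW' := R.card_eq A W' hW'A
    obtain ⟨n, hn⟩ := hwin W' hW'
    have hmem := hn (n + 1) n.le_succ
    have hne : (R.choice A ∩ R.choice (nCopies (n + 1) (α W W'))).Nonempty := by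
      rw [hCo.choice_nCopies_succ, hα W W' hW hW']
      exact ⟨W', hW'A, Set.mem_insert_of_mem W rfl⟩
    rw [hCo _ _ hne] at hmem
    exact hmem.1

end ABC
end
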